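/- Fix an integer d ≥ 1 and let γ ∈ (0, d/(d+1)]. Then slowdown signaling can strictly improve congestion: there exist a parallel routing problem G whose latency functions have the form ℓ_e(y) = a_e·y^d + b_e with constants a_e, b_e ≥ 0, a sensitivity distribution β, a Nash flow f_γ of (G, β, γ), and a Nash flow f_0 of (G, β, 0) such that L(f_γ) < L(f_0). -/

import Mathlib

open MeasureTheory

/-- A nonatomic routing problem: finite edge set, finite commodity set, traffic
rates, finite nonempty path sets, and nondecreasing convex continuously
differentiable nonnegative latency functions. -/
structure RoutingProblem where
  E : Type
  instFintypeE : Fintype E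
  instDecEqE : DecidableEq E
  C : Type
  instFintypeC : Fintype C
  r : C → ℝ
  r_pos : ∀ c, 0 < r c
  paths : C → Finset (Finset E)
  paths_nonempty : ∀ c, (paths c).Nonempty
  lat : E → ℝ → ℝ
  lat_nonneg : ∀ e y, 0 ≤ y → 0 ≤ lat e y
  lat_mono : ∀ e, MonotoneOn (lat e) (Set.Ici 0)
  lat_convex : ∀ e, ConvexOn ℝ (Set.Ici 0) (lat e)
  lat_smooth : ∀ e, ContDiffOn ℝ 1 (lat e) (Set.Ici 0)

attribute [instance] RoutingProblem.instFintypeE RoutingProblem.instDecEqE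
  RoutingProblem.instFintypeC

namespace RoutingProblem

variable (G : RoutingProblem)

/-- `σ` is a valid assignment of users `[0, r c]` to paths of their commodity,
measurable in the sense that each preimage of a path is measurable. -/
def IsAssignment (σ : G.C → ℝ → Finset G.E) : Prop :=
  (∀ c x, x ∈ Set.Icc 0 (G.r c) → σ c x ∈ G.paths c) ∧
  (∀ c (p : Finset G.E), MeasurableSet {x : ℝ | σ c x = p})

/-- The edge flow induced by an assignment. -/
noncomputable def edgeFlow (σ : G.C → ℝ → Finset G.E) (e : G.E) : ℝ :=
  ∑ c, (volume {x : ℝ | x ∈ Set.Icc 0 (G.r c) ∧ e ∈ σ c x}).toReal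

/-- The path flow induced by an assignment. -/
noncomputable def pathFlow (σ : G.C → ℝ → Finset G.E) (p : Finset G.E) : ℝ :=
  ∑ c, (volume {x : ℝ | x ∈ Set.Icc 0 (G.r c) ∧ σ c x = p}).toReal

/-- Total latency of an edge-flow vector. -/
noncomputable def totalLatency (f : G.E → ℝ) : ℝ :=
  ∑ e, f e * G.lat e (f e)

/-- `β` is a sensitivity distribution: for each commodity a nondecreasing
measurable function into `[0,1]`. -/
def IsSensitivity (β : G.C → ℝ → ℝ) : Prop :=
  ∀ c, MonotoneOn (β c) (Set.Icc 0 (G.r c)) ∧ Measurable (β c) ∧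
    ∀ x ∈ Set.Icc 0 (G.r c), β c x ∈ Set.Icc (0:ℝ) 1

/-- Slowdown-sensitivity cost of path `p` under edge flow `f` for user `x` of
commodity `c`, given signal `γ`. -/
noncomputable def cost (β : G.C → ℝ → ℝ) (γ : ℝ) (c : G.C) (x : ℝ)
    (p : Finset G.E) (f : G.E → ℝ) : ℝ :=
  ∑ e ∈ p, (G.lat e (f e) - γ * β c x * G.lat e 0)

/-- Nash flow for a general family of user cost functions `K c x p f`. -/
def IsNashFor (K : G.C → ℝ → Finset G.E → (G.E → ℝ) → ℝ)
    (σ : G.C → ℝ → Finset G.E) : Prop :=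
  G.IsAssignment σ ∧
  ∀ c, ∀ᵐ x ∂(volume.restrict (Set.Icc 0 (G.r c))),
    ∀ p ∈ G.paths c, K c x (σ c x) (G.edgeFlow σ) ≤ K c x p (G.edgeFlow σ)

/-- Nash flow of the slowdown-sensitivity game `(G, β, γ)`. -/
def IsNashFlow (β : G.C → ℝ → ℝ) (γ : ℝ) (σ : G.C → ℝ → Finset G.E) : Prop :=
  G.IsNashFor (G.cost β γ) σ

/-- All latency functions are polynomials `a_e y^d + b_e` with `a_e, b_e ≥ 0`. -/
def IsPolyDeg (d : ℕ) : Prop :=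
  ∀ e, ∃ a b : ℝ, 0 ≤ a ∧ 0 ≤ b ∧ ∀ y : ℝ, G.lat e y = a * y ^ d + b

/-- Parallel network: each path is a single edge and distinct paths are disjoint. -/
def IsParallel : Prop :=
  (∀ c, ∀ p ∈ G.paths c, p.card = 1) ∧
  (∀ c c', ∀ p ∈ G.paths c, ∀ p' ∈ G.paths c', p ≠ p' → Disjoint p p')

/-- A feasible (fractional) path-flow vector. -/
def IsFeasible (g : G.C → Finset G.E → ℝ) : Prop :=
  (∀ c p, 0 ≤ g c p) ∧ (∀ c p, p ∉ G.paths c → g c p = 0) ∧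
  (∀ c, ∑ p ∈ G.paths c, g c p = G.r c)

/-- Edge flow induced by a fractional path-flow vector. -/
noncomputable def flowOf (g : G.C → Finset G.E → ℝ) (e : G.E) : ℝ :=
  ∑ c, ∑ p ∈ G.paths c, if e ∈ p then g c p else 0

/-- Minimum total latency over feasible flows. -/
noncomputable def optLatency : ℝ :=
  sInf {L : ℝ | ∃ g, G.IsFeasible g ∧ L = G.totalLatency (G.flowOf g)}

/-- The Rosenthal-type potential of the slowdown-sensitivity game. -/
noncomputable def potential (β : G.C → ℝ → ℝ) (γ : ℝ)
    (σ : G.C → ℝ → Finset G.E) : ℝ :=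
  (∑ e, ∫ t in (0:ℝ)..(G.edgeFlow σ e), G.lat e t) -
    γ * ∑ c, ∫ x in Set.Icc (0:ℝ) (G.r c), β c x * ∑ e ∈ σ c x, G.lat e 0

end RoutingProblem

lemma path_cases (p : Finset Bool) (hp : p ∈ ({{false}, {true}} : Finset (Finset Bool))) :
    p = {false} ∨ p = {true} := by
  simpa using hp

/-- Pigou network of degree `d`. -/
noncomputable def pigou (d : ℕ) : RoutingProblem where
  E := Bool
  instFintypeE := inferInstance
  instDecEqE := inferInstance
  C := Unit
  instFintypeC := inferInstance
  r := fun _ => 1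
  r_pos := fun _ => one_pos
  paths := fun _ => {{false}, {true}}
  paths_nonempty := fun _ => ⟨{false}, by simp⟩
  lat := fun e y => (cond e 0 1) * y ^ d + cond e 1 0
  lat_nonneg := by
    intro e y hy
    cases e <;> simp [hy]
  lat_mono := by
    intro e x hx y hy hxy
    cases e
    · simpa using pow_le_pow_left₀ hx hxy d
    · simp
  lat_convex := by
    intro e
    cases e
    · simpa using convexOn_pow d
    · simpa using convexOn_const (1:ℝ) (convex_Ici (0:ℝ))
  lat_smooth := by
    intro e
    apply ContDiff.contDiffOn
    fun_prop

/-- Threshold assignment. -/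
noncomputable def thr (t : ℝ) : Unit → ℝ → Finset Bool :=
  fun _ x => if x ≤ t then {false} else {true}

lemma thr_assign (d : ℕ) (t : ℝ) : (pigou d).IsAssignment (thr t) := by
  constructor
  · intro c x _
    change (if x ≤ t then ({false} : Finset Bool) else {true}) ∈
      ({{false}, {true}} : Finset (Finset Bool))
    split_ifs <;> simp
  · intro c p
    have : {x : ℝ | thr t c x = p} =
        (Set.Iic t ∩ {_x : ℝ | ({false} : Finset Bool) = p}) ∪
        (Set.Ioi t ∩ {_x : ℝ | ({true} : Finset Bool) = p}) := by
      ext x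
      by_cases h : x ≤ t
      · simp [thr, h]
      · simp [thr, h, not_le.mp h]
    change MeasurableSet {x : ℝ | thr t c x = p}
    rw [this]
    exact (measurableSet_Iic.inter (MeasurableSet.const _)).union
      (measurableSet_Ioi.inter (MeasurableSet.const _))

lemma thr_flow_false (d : ℕ) (t : ℝ) (h0 : 0 ≤ t) (h1 : t ≤ 1) :
    (pigou d).edgeFlow (thr t) false = t := by
  change ∑ c : Unit, (volume {x : ℝ | x ∈ Set.Icc (0:ℝ) 1 ∧ false ∈ thr t c x}).toReal = t
  have : {x : ℝ | x ∈ Set.Icc (0:ℝ) 1 ∧ false ∈ thr t () x} = Set.Icc 0 t := by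
    ext x
    by_cases h : x ≤ t
    · simp [thr, h]; intro; linarith
    · simp [thr, h]
  rw [Fintype.sum_unique]
  refine (congrArg (fun s => (volume s).toReal) this).trans ?_
  simp [h0]

lemma thr_flow_true (d : ℕ) (t : ℝ) (h0 : 0 ≤ t) (h1 : t ≤ 1) :
    (pigou d).edgeFlow (thr t) true = 1 - t := by
  change ∑ c : Unit, (volume {x : ℝ | x ∈ Set.Icc (0:ℝ) 1 ∧ true ∈ thr t c x}).toReal = 1 - t
  have : {x : ℝ | x ∈ Set.Icc (0:ℝ) 1 ∧ true ∈ thr t () x} = Set.Ioc t 1 := by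
    ext x
    by_cases h : x ≤ t
    · simp [thr, h]
    · simp [thr, h, not_le.mp h]; intro; linarith
  rw [Fintype.sum_unique]
  refine (congrArg (fun s => (volume s).toReal) this).trans ?_
  simp [h1]

lemma thr_total (d : ℕ) (t : ℝ) (h0 : 0 ≤ t) (h1 : t ≤ 1) :
    (pigou d).totalLatency ((pigou d).edgeFlow (thr t)) = t * t ^ d + (1 - t) := by
  have e : ∀ f : Bool → ℝ, (pigou d).totalLatency f =
      f true * (0 * f true ^ d + 1) + f false * (1 * f false ^ d + 0) := by
    intro f
    change ∑ e : Bool, f e * ((cond e 0 1) * f e ^ d + cond e 1 0) = _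
    simp
  refine (e _).trans ?_
  have h := thr_flow_false d t h0 h1
  have h' := thr_flow_true d t h0 h1
  rw [h, h']
  ring

lemma thr_nash (d : ℕ) (hd : 1 ≤ d) (γ t : ℝ) (h0 : 0 ≤ t) (h1 : t ≤ 1)
    (h : t ^ d = 1 - γ) : (pigou d).IsNashFlow (fun _ _ => 1) γ (thr t) := by
  refine ⟨thr_assign d t, ?_⟩
  intro c
  have hd0 : d ≠ 0 := by omega
  have cf : ∀ x, (pigou d).cost (fun _ _ => 1) γ c x ({false} : Finset Bool)
      ((pigou d).edgeFlow (thr t)) = 1 - γ := by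
    intro x
    refine (Finset.sum_singleton (ι := Bool) _ false).trans ?_
    rw [thr_flow_false d t h0 h1]
    simp [pigou, hd0, h]
  have ct : ∀ x, (pigou d).cost (fun _ _ => 1) γ c x ({true} : Finset Bool)
      ((pigou d).edgeFlow (thr t)) = 1 - γ := by
    intro x
    refine (Finset.sum_singleton (ι := Bool) _ true).trans ?_
    rw [thr_flow_true d t h0 h1]
    simp [pigou]
  have key : ∀ x, ∀ p ∈ (pigou d).paths c, (pigou d).cost (fun _ _ => 1) γ c x p
      ((pigou d).edgeFlow (thr t)) = 1 - γ := by
    intro x p hp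
    have hp' := path_cases _ hp
    rcases hp' with rfl | rfl
    · exact cf x
    · exact ct x
  filter_upwards [ae_restrict_mem measurableSet_Icc] with x hx p hp
  rw [key x p hp, key x _ ((thr_assign d t).1 c x hx)]

/-- every signal `γ ∈ (0, d/(d+1)]` can strictly improve
congestion on some parallel routing problem with degree-`d` latencies. -/
theorem signal_can_strictly_improve (d : ℕ) (hd : 1 ≤ d) (γ : ℝ)
    (hγ : γ ∈ Set.Ioc (0:ℝ) ((d : ℝ) / ((d : ℝ) + 1))) :
    ∃ G : RoutingProblem, G.IsParallel ∧ G.IsPolyDeg d ∧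
      ∃ β : G.C → ℝ → ℝ, G.IsSensitivity β ∧
        ∃ σγ σ0 : G.C → ℝ → Finset G.E,
          G.IsNashFlow β γ σγ ∧ G.IsNashFlow β 0 σ0 ∧
            G.totalLatency (G.edgeFlow σγ) < G.totalLatency (G.edgeFlow σ0) := by
  obtain ⟨hγ0, hγ1⟩ := hγ
  have hlt : γ < 1 := by
    refine lt_of_le_of_lt hγ1 ?_
    rw [div_lt_one (by positivity)]
    linarith
  have hd0 : d ≠ 0 := by omega
  obtain ⟨t, ht0, ht1, ht⟩ : ∃ t : ℝ, 0 < t ∧ t < 1 ∧ t ^ d = 1 - γ := by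
    have hp : 0 < 1 - γ := by linarith
    refine ⟨(1 - γ) ^ ((d : ℝ)⁻¹), by positivity, ?_, Real.rpow_inv_natCast_pow hp.le hd0⟩
    exact Real.rpow_lt_one hp.le (by linarith) (by positivity)
  refine ⟨pigou d, ⟨?_, ?_⟩, ?_, fun _ _ => 1, ?_, thr t, thr 1,
    thr_nash d hd γ t ht0.le ht1.le ht, thr_nash d hd 0 1 zero_le_one le_rfl (by simp), ?_⟩
  · intro c p hp
    have hp' := path_cases _ hp
    rcases hp' with rfl | rfl <;> rfl
  · intro c c' p hp q hq hne
    have hp' := path_cases _ hp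
    have hq' := path_cases _ hq
    rcases hp' with rfl | rfl <;> rcases hq' with rfl | rfl
    · exact absurd rfl hne
    · exact Finset.disjoint_singleton.2 (fun h => Bool.noConfusion h)
    · exact Finset.disjoint_singleton.2 (fun h => Bool.noConfusion h)
    · exact absurd rfl hne
  · intro e
    have hab : ∀ e : Bool, (0:ℝ) ≤ cond e 0 1 ∧ (0:ℝ) ≤ cond e 1 0 := by
      intro e; cases e <;> simp
    exact ⟨_, _, (hab e).1, (hab e).2, fun y => rfl⟩
  · intro c
    exact ⟨monotoneOn_const, measurable_const, fun x _ => by simp⟩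
  · rw [thr_total d t ht0.le ht1.le, thr_total d 1 zero_le_one le_rfl, ht]
    simp only [one_pow]
    nlinarith [mul_pos ht0 hγ0]
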